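/- Let d ≥ 2 be an integer, N > 0 a real number, and p ∈ [0,1]. Suppose there exist a Hermitian β ∈ M_d with Re(tr β) = N and PSD d²×d² matrices J_A, J_B such that J_A − J_B = SWAP − (1/d)·(I ⊗ I) + β ⊗ I and (1 + √p)·Re(tr J_B) = (1 − √p)·Re(tr J_A). Then √p·(d² + N − 1) ≤ N·d; in particular p ≤ (N·d/(d² + N − 1))². (Upper bound on the success probability of probabilistic exact unitary transposition with N queries.) -/

import Mathlib

open Matrix
open scoped Kronecker ComplexOrder

/-- The SWAP operator on `ℂ^d ⊗ ℂ^d`. -/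
noncomputable def SwapMat (d : ℕ) : Matrix (Fin d × Fin d) (Fin d × Fin d) ℂ :=
  Matrix.of fun p q =>
    (if p.1 = q.2 then (1 : ℂ) else 0) * (if p.2 = q.1 then (1 : ℂ) else 0)

theorem swapMat_mul_apply {d : ℕ} (M : Matrix (Fin d × Fin d) (Fin d × Fin d) ℂ) (i j : Fin d)
    (q : Fin d × Fin d) : (SwapMat d * M) (i, j) q = M (j, i) q := by
  simp [SwapMat, Matrix.mul_apply, Fintype.sum_prod_type, -mul_ite]

theorem swapMat_mul_self (d : ℕ) : SwapMat d * SwapMat d = 1 := by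
  ext ⟨i, j⟩ ⟨k, l⟩
  rw [swapMat_mul_apply]
  simp [SwapMat, Matrix.one_apply, ← ite_and, and_comm]

theorem swapMat_conjTranspose (d : ℕ) : (SwapMat d)ᴴ = SwapMat d := by
  ext ⟨i, j⟩ ⟨k, l⟩
  simp [SwapMat, apply_ite, eq_comm, and_comm, ← ite_and]

theorem trace_swapMat_mul_kronecker {d : ℕ} (A B : Matrix (Fin d) (Fin d) ℂ) :
    (SwapMat d * (A ⊗ₖ B)).trace = (A * B).trace := by
  simp only [Matrix.trace, Matrix.diag_apply, Fintype.sum_prod_type, swapMat_mul_apply,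
    Matrix.kroneckerMap_apply]
  simp only [Matrix.mul_apply]
  exact Finset.sum_comm

theorem trace_swapMat (d : ℕ) : (SwapMat d).trace = d := by
  simpa using trace_swapMat_mul_kronecker (1 : Matrix (Fin d) (Fin d) ℂ) 1

/-- An involutive Hermitian matrix is at most the identity, tested against a positive
semidefinite matrix. -/
theorem Matrix.PosSemidef.re_trace_mul_le {n : Type*} [Fintype n] [DecidableEq n]
    {J S : Matrix n n ℂ} (hJ : J.PosSemidef) (hS : Sᴴ = S) (hSS : S * S = 1) :
    (S * J).trace.re ≤ J.trace.re := by
  have h := (hJ.mul_mul_conjTranspose_same (1 - S)).trace_nonneg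
  have key : ((1 - S) * J * (1 - S)ᴴ).trace = 2 * (J.trace - (S * J).trace) := by
    rw [Matrix.trace_mul_comm, ← Matrix.mul_assoc, Matrix.conjTranspose_sub,
      Matrix.conjTranspose_one, hS]
    have : (1 - S) * (1 - S) = (2 : ℂ) • (1 - S) := by
      rw [sub_mul, mul_sub, mul_sub, hSS, two_smul]
      simp only [one_mul, mul_one]
      abel
    rw [this, Matrix.smul_mul, Matrix.trace_smul, sub_mul, one_mul, Matrix.trace_sub, smul_eq_mul]
  rw [key] at h
  have h' := (Complex.le_def.1 h).1
  simp at h'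
  linarith

theorem prob_transposition_upper_bound (d : ℕ) (hd : 2 ≤ d)
    (N : ℝ) (hN : 0 < N) (p : ℝ) (hp0 : 0 ≤ p) (hp1 : p ≤ 1)
    (h : ∃ (β : Matrix (Fin d) (Fin d) ℂ)
        (J_A J_B : Matrix (Fin d × Fin d) (Fin d × Fin d) ℂ),
        β.IsHermitian ∧ (β.trace).re = N ∧ J_A.PosSemidef ∧ J_B.PosSemidef ∧
        J_A - J_B = SwapMat d - ((1 : ℂ)/d) • ((1 : Matrix (Fin d) (Fin d) ℂ) ⊗ₖ 1)
          + β ⊗ₖ (1 : Matrix (Fin d) (Fin d) ℂ) ∧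
        (1 + Real.sqrt p) * (J_B.trace).re = (1 - Real.sqrt p) * (J_A.trace).re) :
    Real.sqrt p * ((d : ℝ)^2 + N - 1) ≤ N * d ∧
      p ≤ (N * d / ((d : ℝ)^2 + N - 1))^2 := by
  obtain ⟨β, J_A, J_B, -, hβ, hA, hB, hJ, hp⟩ := h
  have hd0 : (d : ℂ) ≠ 0 := by
    exact_mod_cast (by omega : d ≠ 0)
  have hd2 : (2 : ℝ) ≤ d := by exact_mod_cast hd
  have htr : J_A.trace.re - J_B.trace.re = N * d := by
    have : J_A.trace - J_B.trace = β.trace * d := by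
      rw [← Matrix.trace_sub, hJ, Matrix.trace_add, Matrix.trace_sub, Matrix.trace_smul,
        Matrix.trace_kronecker, Matrix.trace_kronecker, trace_swapMat]
      simp only [Matrix.trace_one, Fintype.card_fin, smul_eq_mul]
      field_simp
      ring
    rw [← Complex.sub_re, this]
    simp [hβ]
  have hswap : (SwapMat d * J_A).trace.re - (SwapMat d * J_B).trace.re = (d : ℝ) ^ 2 + N - 1 := by
    have : (SwapMat d * J_A).trace - (SwapMat d * J_B).trace
        = ((((d : ℝ) ^ 2 - 1 : ℝ)) : ℂ) + β.trace := by
      rw [← Matrix.trace_sub, ← mul_sub, hJ, mul_add, mul_sub, Matrix.mul_smul, Matrix.trace_add,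
        Matrix.trace_sub, Matrix.trace_smul, trace_swapMat_mul_kronecker,
        trace_swapMat_mul_kronecker, swapMat_mul_self]
      simp only [mul_one, Matrix.trace_one, Fintype.card_fin, Fintype.card_prod, smul_eq_mul]
      push_cast
      field_simp
    rw [← Complex.sub_re, this, Complex.add_re, Complex.ofReal_re, hβ]
    ring
  have hle_A := hA.re_trace_mul_le (swapMat_conjTranspose d) (swapMat_mul_self d)
  have hle_B := hB.re_trace_mul_le (S := -SwapMat d)
    (by rw [Matrix.conjTranspose_neg, swapMat_conjTranspose])
    (by rw [neg_mul_neg, swapMat_mul_self])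
  rw [neg_mul, Matrix.trace_neg, Complex.neg_re] at hle_B
  have hmain : √p * ((d : ℝ) ^ 2 + N - 1) ≤ N * d := by
    have : √p * ((d : ℝ) ^ 2 + N - 1) ≤ √p * (J_A.trace.re + J_B.trace.re) :=
      mul_le_mul_of_nonneg_left (by linarith) (Real.sqrt_nonneg p)
    linarith
  refine ⟨hmain, ?_⟩
  have hpos : 0 < (d : ℝ) ^ 2 + N - 1 := by nlinarith
  rw [← Real.sq_sqrt hp0]
  exact pow_le_pow_left₀ (Real.sqrt_nonneg p) ((le_div_iff₀ hpos).2 hmain) 2
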